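/- Let L be a language over Σ = Σ₀ ∪ {0} and G ⊆ Σ₀·Σ*·Σ₀ a finite set of guides. If L is regular and there is a number k ≥ 0 such that no string of L or of G contains k (or more) consecutive 0's, then the language L_{i/d} is regular. -/

import Mathlib

/-- The homomorphism `π` erasing the distinguished symbol `0` (modelled as `none`). -/
def eraseZeros {α₀ : Type} (u : List (Option α₀)) : List α₀ := u.filterMap id

/-- A guided insertion/deletion step: a substring `y ∈ Σ₀·Σ*·Σ₀` of `u` with
`π(y) = π(g)` for some guide `g ∈ G` is replaced by `g`. -/
def IdStep {α₀ : Type} (G : Set (List (Option α₀))) (u v : List (Option α₀)) : Prop :=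
  ∃ g ∈ G, ∃ x y z : List (Option α₀),
    u = x ++ y ++ z ∧ v = x ++ g ++ z ∧
    (∃ (a b : α₀) (m : List (Option α₀)), y = some a :: m ++ [some b]) ∧
    eraseZeros y = eraseZeros g

/-- placed word -/
def cellG {γ : Type} (n : ℤ) (w : List γ) (i : ℤ) : Option γ :=
  if 0 ≤ i + n then w[(i + n).toNat]? else none

def ClosedG {γ : Type} (P : Set (ℤ → Option γ)) (D : ℤ → Option γ) (S : Set ℤ) : Prop :=
  ∀ q ∈ P, (∀ i, q i ≠ none → D i = q i ∨ i ∈ S) → ∀ i, q i ≠ none → i ∈ S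

def clG {γ : Type} (P : Set (ℤ → Option γ)) (D : ℤ → Option γ) (S₀ : Set ℤ) : Set ℤ :=
  {i | ∀ S, ClosedG P D S → S₀ ⊆ S → i ∈ S}

def patG {α β : Type} (G : Set (α × List (β × α))) (C : ℤ → Option (β × α)) : Set (ℤ → Option (β × α)) :=
  {q | ∃ a p, (a, p) ∈ G ∧ ∃ s : ℤ, (C s).map Prod.snd = some a ∧ q = cellG (-(s+1)) p ∧
    ∀ i e, q i = some e → (C i).map Prod.snd = some e.2}

def CStepG {α β : Type} (G : Set (α × List (β × α))) (u v : List (β × α)) : Prop :=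
  ∃ a p, (a, p) ∈ G ∧ ∃ x b y z, u = x ++ (b, a) :: (y ++ z) ∧ v = x ++ (b, a) :: (p ++ z) ∧
    y.map Prod.snd = p.map Prod.snd

def negG {γ : Type} (C : ℤ → Option γ) (i : ℤ) : Option γ := if i < 0 then C i else none

theorem clG_closed {γ : Type} (P : Set (ℤ → Option γ)) (D S₀) : ClosedG P D (clG P D S₀) := by
  intro q hq hc i hi S hS h0
  refine hS q hq (fun j hj => ?_) i hi
  rcases hc j hj with h | h
  · exact Or.inl h
  · exact Or.inr (h S hS h0)

theorem subset_clG {γ : Type} (P : Set (ℤ → Option γ)) (D S₀) : S₀ ⊆ clG P D S₀ :=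
  fun _ hi _ _ h0 => h0 hi

theorem clG_min {γ : Type} {P : Set (ℤ → Option γ)} {D S₀ S} (h : ClosedG P D S) (h0 : S₀ ⊆ S) :
    clG P D S₀ ⊆ S := fun _ hi => hi S h h0

theorem cellG_some {γ : Type} {n : ℤ} {w : List γ} {i : ℤ} :
    cellG n w i ≠ none ↔ 0 ≤ i + n ∧ i + n < w.length := by
  unfold cellG
  split_ifs with h
  · simp [h]
  · simp [h]

theorem patG_neg {α β : Type} {G : Set (α × List (β × α))} {C q} (hq : q ∈ patG G (negG C)) :
    q ∈ patG G C ∧ ∀ i, q i ≠ none → i < 0 := by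
  obtain ⟨a, p, hG, s, hs, rfl, h⟩ := hq
  have key : ∀ i (a : α), (negG C i).map Prod.snd = some a → i < 0 ∧ (C i).map Prod.snd = some a := by
    intro i a; unfold negG; split_ifs with h <;> simp [h]
  refine ⟨⟨a, p, hG, s, (key _ _ hs).2, rfl, fun i e he => (key _ _ (h i e he)).2⟩, fun i hi => ?_⟩
  obtain ⟨e, he⟩ := Option.ne_none_iff_exists'.1 hi
  exact (key _ _ (h i e he)).1

theorem patG_split {α β : Type} {G : Set (α × List (β × α))} {l : ℕ} (hl : ∀ g ∈ G, g.2.length ≤ l)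
    {C q} (hq : q ∈ patG G C) :
    q ∈ patG G (negG C) ∨ ((∀ D, (∀ i, -(l:ℤ) ≤ i → D i = C i) → q ∈ patG G D) ∧
      ∀ i, q i ≠ none → -(l:ℤ) ≤ i) := by
  obtain ⟨a, p, hG, s, hs, rfl, h⟩ := hq
  have hp := hl _ hG
  simp only at hp
  by_cases hc : s + p.length < 0
  · left
    refine ⟨a, p, hG, s, ?_, rfl, fun i e he => ?_⟩
    · rw [negG, if_pos (by omega)]; exact hs
    · have := cellG_some.1 (by rw [he]; simp : cellG (-(s+1)) p i ≠ none)
      rw [negG, if_pos (by omega)]; exact h i e he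
  · right
    refine ⟨fun D hD => ⟨a, p, hG, s, ?_, rfl, fun i e he => ?_⟩, fun i hi => ?_⟩
    · rw [hD _ (by omega)]; exact hs
    · have := cellG_some.1 (by rw [he]; simp : cellG (-(s+1)) p i ≠ none)
      rw [hD _ (by omega)]; exact h i e he
    · have := cellG_some.1 hi
      omega

theorem negG_lt {γ : Type} {C : ℤ → Option γ} {i : ℤ} (h : i < 0) : negG C i = C i := by
  simp [negG, h]

theorem cl_neg_sub {α β : Type} (G : Set (α × List (β × α))) (C) (T : Set ℤ)
    (hT : T ⊆ clG (patG G C) C ∅) : clG (patG G (negG C)) (negG C) T ⊆ clG (patG G C) C ∅ := by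
  refine clG_min ?_ hT
  intro q hq hc
  obtain ⟨h1, h2⟩ := patG_neg hq
  refine clG_closed (patG G C) C ∅ q h1 fun i hi => ?_
  rw [← negG_lt (C := C) (h2 i hi)]; exact hc i hi

theorem swap_aux {α β : Type} {G : Set (α × List (β × α))} {l : ℕ} (hl : ∀ g ∈ G, g.2.length ≤ l)
    {C D : ℤ → Option (β × α)} (hCD : ∀ i, -(l:ℤ) ≤ i → D i = C i)
    (hF : ∀ T : Set ℤ, (∀ i ∈ T, -(l:ℤ) ≤ i ∧ i < 0) → ∀ i, -(l:ℤ) ≤ i → i < 0 →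
      (i ∈ clG (patG G (negG C)) (negG C) T ↔ i ∈ clG (patG G (negG D)) (negG D) T)) 
    (T : Set ℤ) (hT : T = {i | i ∈ clG (patG G C) C ∅ ∧ -(l:ℤ) ≤ i ∧ i < 0}) :
    (∀ i, -(l:ℤ) ≤ i → i ∈ clG (patG G D) D ∅ → i ∈ clG (patG G C) C ∅) ∧
    (∀ i, i < 0 → i ∈ clG (patG G D) D ∅ → i ∈ clG (patG G (negG D)) (negG D) T) := by
  have hTK : T ⊆ clG (patG G C) C ∅ := by rw [hT]; exact fun i hi => hi.1
  have hTw : ∀ i ∈ T, -(l:ℤ) ≤ i ∧ i < 0 := by rw [hT]; exact fun i hi => hi.2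
  have ha := cl_neg_sub G C T hTK
  have hb : clG (patG G (negG D)) (negG D) T ⊆ {i | i < 0} :=
    clG_min (fun q hq _ => (patG_neg hq).2) (fun i hi => (hTw i hi).2)
  set K := clG (patG G C) C ∅ with hK
  set Q : Set ℤ := clG (patG G (negG D)) (negG D) T ∪ {i | i ∈ K ∧ 0 ≤ i} with hQ
  have hcc : ∀ i, -(l:ℤ) ≤ i → (i ∈ Q ↔ i ∈ K) := by
    intro i hi
    by_cases h0 : i < 0
    · have : i ∈ Q ↔ i ∈ clG (patG G (negG D)) (negG D) T := by
        simp [hQ]; omega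
      rw [this, ← hF T hTw i hi h0]
      refine ⟨fun h => ha h, fun h => subset_clG _ _ _ ?_⟩
      rw [hT]; exact ⟨h, hi, h0⟩
    · have : i ∉ clG (patG G (negG D)) (negG D) T := fun h => h0 (hb h)
      simp [hQ, this]; omega
  have hcl : ClosedG (patG G D) D Q := by
    intro q hq hcon i hi
    rcases patG_split hl hq with h | ⟨h1, h2⟩
    · have hn := (patG_neg h).2
      left
      refine clG_closed _ _ _ q h (fun j hj => ?_) i hi
      rw [negG_lt (hn j hj)]
      rcases hcon j hj with h | h | h
      · exact Or.inl h
      · exact Or.inr h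
      · have := hn j hj; have := h.2; omega
    · rw [hcc i (h2 i hi)]
      refine clG_closed (patG G C) C ∅ q (h1 C fun i hi => (hCD i hi).symm) (fun j hj => ?_) i hi
      rw [← hCD j (h2 j hj)]
      rcases hcon j hj with h | h
      · exact Or.inl h
      · exact Or.inr ((hcc j (h2 j hj)).1 h)
  have hsub := clG_min hcl (Set.empty_subset Q)
  refine ⟨fun i hi h => (hcc i hi).1 (hsub h), fun i hi h => ?_⟩
  rcases hsub h with h | h
  · exact h
  · have := h.2; omega

theorem swap_main {α β : Type} {G : Set (α × List (β × α))} {l : ℕ} (hl : ∀ g ∈ G, g.2.length ≤ l)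
    {C D : ℤ → Option (β × α)} (hCD : ∀ i, -(l:ℤ) ≤ i → D i = C i)
    (hF : ∀ T : Set ℤ, (∀ i ∈ T, -(l:ℤ) ≤ i ∧ i < 0) → ∀ i, -(l:ℤ) ≤ i → i < 0 →
      (i ∈ clG (patG G (negG C)) (negG C) T ↔ i ∈ clG (patG G (negG D)) (negG D) T)) :
    ∃ T : Set ℤ, (∀ i ∈ T, -(l:ℤ) ≤ i ∧ i < 0) ∧
    (∀ i, 0 ≤ i → (i ∈ clG (patG G C) C ∅ → i ∈ clG (patG G D) D ∅)) ∧
    (∀ i, i < 0 → i ∈ clG (patG G C) C ∅ → i ∈ clG (patG G (negG C)) (negG C) T) ∧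
    (∀ i, i ∈ clG (patG G (negG D)) (negG D) T → i ∈ clG (patG G D) D ∅) := by
  have h1 := swap_aux hl hCD hF _ rfl
  have h2 := swap_aux hl (fun i hi => (hCD i hi).symm)
    (fun T hT i h h' => (hF T hT i h h').symm) _ rfl
  have h3 := swap_aux hl (C := C) (D := C) (fun i hi => rfl)
    (fun T hT i h h' => Iff.rfl) _ rfl
  refine ⟨_, fun i hi => hi.2, fun i hi => h2.1 i (by omega), h3.2, cl_neg_sub G D _ ?_⟩
  exact fun i hi => h2.1 i hi.2.1 hi.1

theorem exists_step {α β : Type} {G : Set (α × List (β × α))} (n : ℤ) (u : List (β × α)) {q}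
    (hq : q ∈ patG G (cellG n u)) :
    ∃ u', CStepG G u u' ∧ ∀ i, cellG n u' i = (q i).or (cellG n u i) := by
  obtain ⟨a, p, hG, s, hs, rfl, h⟩ := hq
  have hs1 : cellG n u s ≠ none := by intro h; simp [h] at hs
  have hs2 := cellG_some.1 hs1
  obtain ⟨j, hj⟩ : ∃ j : ℕ, s = j - n := ⟨(s + n).toNat, by omega⟩
  subst hj
  have hju : j < u.length := by omega
  have hlen : j + 1 + p.length ≤ u.length := by
    by_cases hp : p.length = 0
    · omega
    · have h1 : cellG (-((j:ℤ) - n+1)) p (j - n + p.length) ≠ none := cellG_some.2 (by omega)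
      obtain ⟨e, he⟩ := Option.ne_none_iff_exists'.1 h1
      have h2 := h _ _ he
      have h3 : cellG n u (j - n + p.length) ≠ none := by intro h; simp [h] at h2
      have := cellG_some.1 h3
      omega
  have hb : u[j].2 = a := by
    simpa [cellG, hju] using hs
  have hmatch : ∀ t e, p[t]? = some e → (u[j+1+t]?).map Prod.snd = some e.2 := by
    intro t e he
    have := h (j - n + 1 + t) e (by
      rw [cellG, if_pos (by omega), ← he]; congr 1; omega)
    rw [cellG, if_pos (by omega)] at this
    rw [← this]; congr 2; omega
  refine ⟨u.take j ++ (u[j].1, a) :: (p ++ u.drop (j+1+p.length)), 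
    ⟨a, p, hG, u.take j, u[j].1, (u.drop (j+1)).take p.length, u.drop (j+1+p.length), ?_, rfl, ?_⟩, ?_⟩
  · subst hb
    rw [← List.drop_drop (i := p.length), List.take_append_drop]
    simp
  · apply List.ext_getElem?
    intro t
    by_cases ht : t < p.length
    · have := hmatch t p[t] (by simp [ht])
      simp [ht] at this ⊢
      exact this
    · simp [ht]
  · intro i
    unfold cellG
    subst hb
    by_cases h0 : 0 ≤ i + n
    · obtain ⟨m, rfl⟩ : ∃ m : ℕ, i = m - n := ⟨(i + n).toNat, by omega⟩
      simp only [sub_add_cancel, Nat.cast_nonneg, if_true, Int.toNat_natCast]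
      rcases lt_trichotomy m j with hm | hm | hm
      · rw [if_neg (by omega), List.getElem?_append_left (by simp; omega)]
        simp [hm]
      · subst hm
        rw [if_neg (by omega), List.getElem?_append_right (by simp)]
        simp [hju.le, hju]
      · rw [if_pos (by omega), List.getElem?_append_right (by simp; omega)]
        obtain ⟨t, rfl⟩ : ∃ t, m = j + 1 + t := ⟨m - j - 1, by omega⟩
        have e1 : j + 1 + t - (u.take j).length = t + 1 := by simp; omega
        have e2 : (((j + 1 + t : ℕ):ℤ) - n + -((j:ℤ) - n + 1)).toNat = t := by omega
        rw [e1, e2, List.getElem?_cons_succ]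
        by_cases ht : t < p.length
        · rw [List.getElem?_append_left ht]; simp [ht]
        · rw [List.getElem?_append_right (by omega), List.getElem?_eq_none (l := p) (by omega)]
          simp; congr 1; omega
    · rw [if_neg h0, if_neg h0, if_neg (by omega)]; rfl

theorem step_pat {α β : Type} {G : Set (α × List (β × α))} (n : ℤ) {u u' : List (β × α)}
    (h : CStepG G u u') : u.map Prod.snd = u'.map Prod.snd ∧ 
    ∃ q ∈ patG G (cellG n u), ∀ i, cellG n u' i = (q i).or (cellG n u i) := by
  obtain ⟨a, p, hG, x, b, y, z, rfl, rfl, hyp⟩ := h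
  have hlen : y.length = p.length := by simpa using congrArg List.length hyp
  refine ⟨by simp [hyp], _, ⟨a, p, hG, x.length - n, ?_, rfl, ?_⟩, ?_⟩
  · simp [cellG]
  · intro i e he
    have hi := cellG_some.1 (by rw [he]; simp : cellG (-((x.length:ℤ) - n +1)) p i ≠ none)
    obtain ⟨t, rfl⟩ : ∃ t : ℕ, i = x.length - n + 1 + t := ⟨(i + (-((x.length:ℤ) - n +1))).toNat, by omega⟩
    have ht : t < p.length := by omega
    rw [cellG, if_pos (by omega)] at he ⊢
    have e1 : ((x.length:ℤ) - n + 1 + t + n).toNat = x.length + (t + 1) := by omega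
    have e2 : ((x.length:ℤ) - n + 1 + t + -((x.length:ℤ) - n +1)).toNat = t := by omega
    rw [e2] at he
    rw [e1, List.getElem?_append_right (by omega), Nat.add_sub_cancel_left, List.getElem?_cons_succ, 
      List.getElem?_append_left (by omega)]
    have := congrArg (·[t]?) hyp
    simp only [List.getElem?_map] at this
    rw [this, he]; rfl
  · intro i
    unfold cellG
    by_cases h0 : 0 ≤ i + n
    · obtain ⟨m, rfl⟩ : ∃ m : ℕ, i = m - n := ⟨(i + n).toNat, by omega⟩
      simp only [sub_add_cancel, Nat.cast_nonneg, if_true, Int.toNat_natCast]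
      rcases lt_trichotomy m x.length with hm | hm | hm
      · rw [if_neg (by omega), List.getElem?_append_left hm, List.getElem?_append_left hm]; rfl
      · subst hm
        rw [if_neg (by omega)]; simp
      · rw [if_pos (by omega)]
        obtain ⟨t, rfl⟩ : ∃ t, m = x.length + (t + 1) := ⟨m - x.length - 1, by omega⟩
        have e2 : (((x.length + (t+1) : ℕ):ℤ) - n + -((x.length:ℤ) - n + 1)).toNat = t := by omega
        rw [e2, List.getElem?_append_right (by omega), List.getElem?_append_right (by omega), 
          Nat.add_sub_cancel_left, List.getElem?_cons_succ, List.getElem?_cons_succ]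
        by_cases ht : t < p.length
        · rw [List.getElem?_append_left ht]; simp [ht]
        · rw [List.getElem?_append_right (by omega), List.getElem?_append_right (by omega), 
            List.getElem?_eq_none (l := p) (by omega), hlen]; simp
    · rw [if_neg h0, if_neg h0, if_neg (by omega)]; rfl

theorem cellG_map_snd {α β : Type} (n : ℤ) (u : List (β × α)) (i : ℤ) :
    (cellG n u i).map Prod.snd = cellG n (u.map Prod.snd) i := by
  unfold cellG; split_ifs <;> simp

theorem patG_congr {α β : Type} (G : Set (α × List (β × α))) (n : ℤ) {u v : List (β × α)}
    (h : u.map Prod.snd = v.map Prod.snd) : patG G (cellG n u) = patG G (cellG n v) := by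
  simp only [patG, cellG_map_snd, h]

theorem reach_imp {α β : Type} {G : Set (α × List (β × α))} (n : ℤ) {u v : List (β × α)}
    (h : Relation.ReflTransGen (CStepG G) u v) : u.map Prod.snd = v.map Prod.snd ∧
      ∀ i ∉ clG (patG G (cellG n v)) (cellG n v) ∅, cellG n u i = cellG n v i := by
  induction h using Relation.ReflTransGen.head_induction_on with
  | refl => exact ⟨rfl, fun _ _ => rfl⟩
  | head h1 _ ih =>
    rename_i a c
    obtain ⟨hm, q, hq, hi⟩ := step_pat n h1
    refine ⟨hm.trans ih.1, fun i hiK => ?_⟩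
    rw [patG_congr G n (hm.trans ih.1)] at hq
    by_cases hqi : q i = none
    · have := hi i
      rw [hqi] at this
      rw [← ih.2 i hiK, this]; rfl
    · exfalso
      apply hiK
      refine clG_closed _ _ _ q hq (fun j hj => ?_) i hqi
      by_cases hjK : j ∈ clG (patG G (cellG n v)) (cellG n v) ∅
      · exact Or.inr hjK
      · left
        rw [← ih.2 j hjK, hi j]
        obtain ⟨e, he⟩ := Option.ne_none_iff_exists'.1 hj
        rw [he]; rfl

theorem cellG_inj {γ : Type} {n : ℤ} {u v : List γ} (h : ∀ i, cellG n u i = cellG n v i) : u = v := by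
  apply List.ext_getElem?
  intro t
  have := h (t - n)
  simpa [cellG] using this

theorem imp_reach {α β : Type} {G : Set (α × List (β × α))} (n : ℤ) {u v : List (β × α)}
    (hm : u.map Prod.snd = v.map Prod.snd)
    (h : ∀ i ∉ clG (patG G (cellG n v)) (cellG n v) ∅, cellG n u i = cellG n v i) :
    Relation.ReflTransGen (CStepG G) u v := by
  let Good : Set ℤ → Prop := fun S => ∀ u : List (β × α), u.map Prod.snd = v.map Prod.snd →
    (∀ i ∉ S, cellG n u i = cellG n v i) → Relation.ReflTransGen (CStepG G) u v
  let U : Set ℤ := {i | cellG n v i ≠ none}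
  have hU : U.Finite := by
    refine (Set.finite_Icc (-n) (v.length - n)).subset fun i hi => ?_
    have := cellG_some.1 hi
    constructor <;> omega
  have hfin : {S : Set ℤ | S ⊆ U ∧ Good S}.Finite := hU.finite_subsets.subset fun S hS => hS.1
  obtain ⟨S, hS⟩ := hfin.exists_maximal ⟨∅, Set.empty_subset _, fun u _ h2 => by
    rw [cellG_inj fun i => h2 i (by simp)]⟩
  have hcl : ClosedG (patG G (cellG n v)) (cellG n v) S := by
    intro q hq hc i hi
    have hgood : Good (S ∪ {i | q i ≠ none}) := by
      intro u hu h2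
      obtain ⟨u', hs, hu'⟩ := exists_step n u (by rwa [patG_congr G n hu])
      refine Relation.ReflTransGen.head hs (hS.prop.2 u' ((step_pat n hs).1.symm.trans hu) fun j hj => ?_)
      rw [hu']
      by_cases hqj : q j = none
      · rw [hqj, ← h2 j (by simp [hj, hqj])]; rfl
      · rcases hc j hqj with h | h
        · rw [h]
          obtain ⟨e, he⟩ := Option.ne_none_iff_exists'.1 hqj
          rw [he]; rfl
        · exact absurd h hj
    refine hS.2 (y := S ∪ {i | q i ≠ none}) ⟨Set.union_subset hS.prop.1 fun j hj => ?_, hgood⟩ 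
      Set.subset_union_left (Or.inr hi)
    obtain ⟨e, he⟩ := Option.ne_none_iff_exists'.1 hj
    obtain ⟨_, _, _, _, _, _, h⟩ := hq
    have := h j e he
    intro hn; simp [hn] at this
  exact hS.prop.2 u hm fun i hi => h i fun hk => hi (clG_min hcl (Set.empty_subset _) hk)

theorem cellG_append_neg {γ : Type} (x z : List γ) {i : ℤ} (hi : i < 0) :
    cellG x.length (x ++ z) i = cellG x.length x i := by
  unfold cellG; split_ifs
  · rw [List.getElem?_append_left (by omega)]
  · rfl

theorem cellG_append_nonneg {γ : Type} (x z : List γ) {i : ℤ} (hi : 0 ≤ i) :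
    cellG x.length (x ++ z) i = z[i.toNat]? := by
  unfold cellG; rw [if_pos (by omega), List.getElem?_append_right (by omega)]
  congr 1; omega

theorem cellG_self_nonneg {γ : Type} (x : List γ) {i : ℤ} (hi : 0 ≤ i) :
    cellG x.length x i = none := by
  by_contra h
  have := cellG_some.1 h
  omega

theorem negG_cell {γ : Type} (x z : List γ) :
    negG (cellG x.length (x ++ z)) = cellG x.length x := by
  funext i
  unfold negG; split_ifs with h
  · exact cellG_append_neg x z h
  · exact (cellG_self_nonneg x (by omega)).symm

def embG {l : ℕ} (T : Set (Fin l)) : Set ℤ := {i | ∃ j ∈ T, i = -((j:ℕ):ℤ) - 1}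

theorem coreG {α β σ : Type} [Finite σ] [Finite α] [Finite β] (G : Set (α × List (β × α))) (l : ℕ)
    (hl : ∀ g ∈ G, g.2.length ≤ l) (φ : List (β × α) → σ) :
    ∃ (τ : Type) (_ : Finite τ) (f : List (β × α) → τ), ∀ x y, f x = f y → ∀ z u,
      Relation.ReflTransGen (CStepG G) u (x ++ z) → ∃ u₀ u₁ u₀', u = u₀ ++ u₁ ∧ φ u₀ = φ u₀' ∧
        Relation.ReflTransGen (CStepG G) (u₀' ++ u₁) (y ++ z) := by
  let K : List (β × α) → Set (Fin l) → Set ℤ := fun x T =>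
    clG (patG G (cellG x.length x)) (cellG x.length x) (embG T)
  let f1 : List (β × α) → Fin l → Option (β × α) := fun x j => cellG x.length x (-((j:ℕ):ℤ) - 1)
  let f2 : List (β × α) → Set (Fin l) → Set (Fin l) := fun x T => {j | -((j:ℕ):ℤ) - 1 ∈ K x T}
  let f3 : List (β × α) → Set (Set (Fin l) × σ) := fun x => {t | ∃ u₀ : List (β × α),
    u₀.map Prod.snd = x.map Prod.snd ∧ (∀ i ∉ K x t.1, cellG x.length u₀ i = cellG x.length x i) ∧
    φ u₀ = t.2}
  refine ⟨(Fin l → Option (β × α)) × (Set (Fin l) → Set (Fin l)) × Set (Set (Fin l) × σ), 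
    inferInstance, fun x => (f1 x, f2 x, f3 x), fun x y hxy z u hu => ?_⟩
  simp only [Prod.mk.injEq] at hxy
  obtain ⟨h1, h2, h3⟩ := hxy
  obtain ⟨hm, hK⟩ := reach_imp (x.length : ℤ) hu
  have hemb : ∀ T : Set ℤ, (∀ i ∈ T, -(l:ℤ) ≤ i ∧ i < 0) → ∃ T' : Set (Fin l), T = embG T' := by
    intro T hT
    refine ⟨{j | -((j:ℕ):ℤ) - 1 ∈ T}, Set.ext fun i => ⟨fun hi => ?_, ?_⟩⟩
    · have := hT i hi
      refine ⟨⟨(-i - 1).toNat, by omega⟩, ?_, ?_⟩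
      · show -(((-i-1).toNat:ℕ):ℤ) - 1 ∈ T
        convert hi using 1; omega
      · show i = -(((-i-1).toNat:ℕ):ℤ) - 1
        omega
    · rintro ⟨j, hj, rfl⟩; exact hj
  obtain ⟨T, hT, s1, s2, s3⟩ := swap_main (G := G) hl (C := cellG x.length (x ++ z))
    (D := cellG y.length (y ++ z)) (by
      intro i hi
      by_cases h0 : i < 0
      · rw [cellG_append_neg _ _ h0, cellG_append_neg _ _ h0]
        have := congrFun h1 ⟨(-i-1).toNat, by omega⟩
        simp only [f1] at this
        have e : -(((-i-1).toNat:ℕ):ℤ) - 1 = i := by omega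
        rw [e] at this
        exact this.symm
      · rw [cellG_append_nonneg _ _ (by omega), cellG_append_nonneg _ _ (by omega)]) (by
      intro T hT i hi h0
      rw [negG_cell, negG_cell]
      obtain ⟨T', rfl⟩ := hemb T hT
      have := Set.ext_iff.1 (congrFun h2 T') ⟨(-i-1).toNat, by omega⟩
      have e : -(((-i-1).toNat:ℕ):ℤ) - 1 = i := by omega
      simp only [f2, K, Set.mem_ofPred_eq, e] at this
      exact this)
  obtain ⟨T', rfl⟩ := hemb T hT
  rw [negG_cell] at s2 s3
  have hul : u.length = x.length + z.length := by simpa using congrArg List.length hm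
  have hx0 : (u.take x.length).length = x.length := by simp [hul]
  have hus : u = u.take x.length ++ u.drop x.length := (List.take_append_drop _ _).symm
  have hcu : ∀ i, cellG x.length u i = cellG (u.take x.length).length (u.take x.length ++ u.drop x.length) i := by
    rw [hx0, ← hus]; simp
  have hmem : (T', φ (u.take x.length)) ∈ f3 x := by
    refine ⟨u.take x.length, ?_, fun i hi => ?_, rfl⟩
    · rw [List.map_take, hm]; simp
    · by_cases h0 : i < 0
      · have := hK i (fun h => hi (s2 i h0 h))
        rw [cellG_append_neg _ _ h0, hcu, cellG_append_neg _ _ h0, hx0] at this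
        exact this
      · rw [cellG_self_nonneg x (by omega)]
        have := cellG_self_nonneg (u.take x.length) (i := i) (by omega)
        rwa [hx0] at this
  rw [h3] at hmem
  obtain ⟨u₀', hm', hK', hφ⟩ := hmem
  have hy0 : u₀'.length = y.length := by simpa using congrArg List.length hm'
  refine ⟨u.take x.length, u.drop x.length, u₀', hus, hφ.symm, imp_reach (y.length : ℤ) ?_ ?_⟩
  · simp only [List.map_append, hm', List.map_drop, hm]
    simp
  · intro i hi
    by_cases h0 : i < 0
    · rw [cellG_append_neg _ _ h0, ← hy0, cellG_append_neg _ _ h0, hy0]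
      exact hK' i fun h => hi (s3 i h)
    · have h0 : 0 ≤ i := by omega
      rw [cellG_append_nonneg _ _ h0, ← hy0, cellG_append_nonneg _ _ h0]
      have := hK i fun h => hi (s1 i h0 h)
      rwa [cellG_append_nonneg _ _ h0, hcu, cellG_append_nonneg _ _ h0] at this

def encG {α : Type} {k : ℕ} (w : List (Fin k × α)) : List (Option α) :=
  w.flatMap fun e => List.replicate e.1 none ++ [some e.2]

theorem encG_append {α : Type} {k : ℕ} (w w' : List (Fin k × α)) :
    encG (w ++ w') = encG w ++ encG w' := by simp [encG]

theorem encG_cons {α : Type} {k : ℕ} (e) (w : List (Fin k × α)) :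
    encG (e :: w) = List.replicate e.1 none ++ some e.2 :: encG w := by simp [encG]

theorem encG_nil {α : Type} {k : ℕ} : encG ([] : List (Fin k × α)) = [] := by simp [encG]

theorem encG_erase {α : Type} {k : ℕ} (w : List (Fin k × α)) :
    eraseZeros (encG w) = w.map Prod.snd := by
  induction w with
  | nil => simp [encG, eraseZeros]
  | cons e w ih =>
    rw [encG_cons]
    simp only [eraseZeros] at ih ⊢
    simp [List.filterMap_append]
    exact ih

theorem encG_len {α : Type} {k : ℕ} (w : List (Fin k × α)) : w.length ≤ (encG w).length := by
  induction w with
  | nil => simp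
  | cons e w ih => rw [encG_cons]; simp; omega

theorem decG {α : Type} {k : ℕ} (s : List (Option α))
    (h : ¬ (List.replicate k (none : Option α) <:+: s)) :
    ∃ (w : List (Fin k × α)) (c : Fin k), s = encG w ++ List.replicate c none := by
  induction s using List.reverseRecOn with
  | nil =>
    have hk : 0 < k := by
      rcases Nat.eq_zero_or_pos k with rfl | h'
      · simp at h
      · exact h'
    exact ⟨[], ⟨0, hk⟩, by simp [encG]⟩
  | append_singleton s a ih =>
    obtain ⟨w, c, hs⟩ := ih fun h' => h (h'.trans (List.prefix_append _ _).isInfix)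
    cases a with
    | none =>
      have e : s ++ [none] = encG w ++ List.replicate (c + 1) none := by
        rw [hs, List.replicate_succ']; simp
      by_cases hc : (c:ℕ) + 1 < k
      · exact ⟨w, ⟨c + 1, hc⟩, e⟩
      · exfalso
        apply h
        have : (c:ℕ) + 1 = k := by have := c.2; omega
        rw [e, this]
        exact (List.suffix_append _ _).isInfix
    | some a =>
      refine ⟨w ++ [(c, a)], ⟨0, by have := c.2; omega⟩, ?_⟩
      rw [encG_append, encG_cons, encG_nil, hs]; simp

theorem decG_some {α : Type} {k : ℕ} (s : List (Option α)) (b : α)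
    (h : ¬ (List.replicate k (none : Option α) <:+: s ++ [some b])) :
    ∃ (w : List (Fin k × α)) (c : Fin k), s ++ [some b] = encG (w ++ [(c, b)]) := by
  obtain ⟨w, c, hs⟩ := decG s fun h' => h (h'.trans (List.prefix_append _ _).isInfix)
  exact ⟨w, c, by rw [encG_append, encG_cons, encG_nil, hs]; simp⟩

theorem rep_inj {α : Type} (n m : ℕ) (a b : α) (A B : List (Option α))
    (h : List.replicate n none ++ some a :: A = List.replicate m none ++ some b :: B) :
    n = m ∧ a = b ∧ A = B := by
  induction n generalizing m with
  | zero =>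
    cases m with
    | zero => simpa using h
    | succ m => simp [List.replicate_succ] at h
  | succ n ih =>
    cases m with
    | zero => simp [List.replicate_succ] at h
    | succ m =>
      simp only [List.replicate_succ, List.cons_append, List.cons.injEq, true_and] at h
      have := ih m h
      exact ⟨by omega, this.2⟩

theorem encG_inj {α : Type} {k : ℕ} (w w' : List (Fin k × α)) (c c' : ℕ)
    (h : encG w ++ List.replicate c none = encG w' ++ List.replicate c' none) :
    w = w' ∧ c = c' := by
  induction w generalizing w' with
  | nil =>
    cases w' with
    | nil => simpa [encG_nil] using congrArg List.length h
    | cons e w' =>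
      exfalso
      have : some e.2 ∈ encG ([] : List (Fin k × α)) ++ List.replicate c (none : Option α) := by
        rw [h, encG_cons]; simp
      simp [encG_nil] at this
  | cons e w ih =>
    cases w' with
    | nil =>
      exfalso
      have : some e.2 ∈ encG ([] : List (Fin k × α)) ++ List.replicate c' (none : Option α) := by
        rw [← h, encG_cons]; simp
      simp [encG_nil] at this
    | cons e' w' =>
      rw [encG_cons, encG_cons, List.append_assoc, List.append_assoc] at h
      obtain ⟨h1, h2, h3⟩ := rep_inj _ _ _ _ _ _ h
      obtain ⟨h4, h5⟩ := ih w' h3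
      exact ⟨by rw [h4, Prod.ext (Fin.ext h1) h2], h5⟩

theorem rep_infix {α : Type} (k n : ℕ) (hn : n < k) (a : α) (R : List (Option α))
    (h : List.replicate k none <:+: List.replicate n none ++ some a :: R) :
    List.replicate k none <:+: R := by
  induction n with
  | zero =>
    rw [List.replicate_zero, List.nil_append, List.infix_cons_iff] at h
    rcases h with h | h
    · obtain ⟨t, ht⟩ := h
      obtain ⟨k, rfl⟩ : ∃ j, k = j + 1 := ⟨k - 1, by omega⟩
      simp [List.replicate_succ] at ht
    · exact h
  | succ n ih =>
    rw [List.replicate_succ, List.cons_append, List.infix_cons_iff] at h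
    rcases h with h | h
    · obtain ⟨t, ht⟩ := h
      have := congrArg (·[n+1]?) ht
      rw [List.getElem?_append_left (by simpa using hn), ← List.cons_append, ← List.replicate_succ,
        List.getElem?_append_right (by simp)] at this
      simp [hn] at this
    · exact ih (by omega) h

theorem encG_nz {α : Type} {k : ℕ} (w : List (Fin k × α)) (c : Fin k) :
    ¬ (List.replicate k (none : Option α) <:+: encG w ++ List.replicate c none) := by
  induction w with
  | nil =>
    intro h
    have := h.length_le
    simp [encG_nil] at this
    have := c.2; omega
  | cons e w ih =>
    rw [encG_cons, List.append_assoc]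
    exact fun h => ih (rep_infix _ _ e.1.2 _ _ h)

def encGuides {α : Type} (k : ℕ) (G : Set (List (Option α))) : Set (α × List (Fin k × α)) :=
  {g | some g.1 :: encG g.2 ∈ G}

theorem idstep_fwd {α : Type} {k : ℕ} {G : Set (List (Option α))}
    (hGform : ∀ g ∈ G, ∃ (a b : α) (m : List (Option α)), g = some a :: m ++ [some b])
    (hGk : ∀ g ∈ G, ¬ (List.replicate k (none : Option α) <:+: g))
    (w : List (Fin k × α)) (c : Fin k) (v : List (Option α))
    (h : IdStep G (encG w ++ List.replicate c none) v) :
    ∃ w', v = encG w' ++ List.replicate c none ∧ CStepG (encGuides k G) w w' := by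
  obtain ⟨g, hg, X, Y, Z, hu, hv, ⟨a, b, m, rfl⟩, he⟩ := h
  have hnz := encG_nz w c
  rw [hu] at hnz
  obtain ⟨x, n, hx⟩ := decG_some X a (k := k) fun h => hnz (h.trans ⟨[], m ++ [some b] ++ Z, by simp⟩)
  obtain ⟨y, n', hy⟩ := decG_some m b (k := k) fun h => hnz (h.trans ⟨X ++ [some a], Z, by simp⟩)
  obtain ⟨z, d, hz⟩ := decG Z (k := k) fun h => hnz (h.trans ⟨X ++ (some a :: m ++ [some b]), [], by simp⟩)
  obtain ⟨a', b', m', rfl⟩ := hGform g hg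
  obtain ⟨p, n'', hp⟩ := decG_some m' b' (k := k) fun h => hGk _ hg (h.trans ⟨[some a'], [], by simp⟩)
  generalize y ++ [(n', b)] = y at hy
  generalize p ++ [(n'', b')] = p at hp
  rw [List.cons_append, List.cons_append, hy, hp] at he
  rw [List.cons_append, hp] at hg
  have e1 : ∀ (a : α) s, eraseZeros (some a :: s) = a :: eraseZeros s := by
    intro a s; simp [eraseZeros]
  rw [e1, e1, encG_erase, encG_erase, List.cons.injEq] at he
  obtain ⟨rfl, he⟩ := he
  have hu' : encG w ++ List.replicate c none = encG (x ++ [(n, a)] ++ y ++ z) ++ List.replicate d none := by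
    rw [hu, encG_append, encG_append, ← hx, ← hy, hz]; simp
  obtain ⟨rfl, hcd⟩ := encG_inj _ _ _ _ hu'
  refine ⟨x ++ [(n, a)] ++ p ++ z, ?_, a, p, hg, x, n, y, z, by simp, by simp, he⟩
  rw [hv, encG_append, encG_append, ← hx, ← hp, hz, hcd]; simp

theorem idstep_bwd {α : Type} {k : ℕ} {G : Set (List (Option α))}
    (hGform : ∀ g ∈ G, ∃ (a b : α) (m : List (Option α)), g = some a :: m ++ [some b])
    (w w' : List (Fin k × α)) (c : ℕ) (h : CStepG (encGuides k G) w w') :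
    IdStep G (encG w ++ List.replicate c none) (encG w' ++ List.replicate c none) := by
  obtain ⟨a, p, hG, x, b, y, z, rfl, rfl, hyp⟩ := h
  refine ⟨_, hG, encG x ++ List.replicate b none, some a :: encG y, encG z ++ List.replicate c none,
    ?_, ?_, ?_, ?_⟩
  · rw [encG_append, encG_cons, encG_append]; simp
  · rw [encG_append, encG_cons, encG_append]; simp
  · have hy : y ≠ [] := by
      rintro rfl
      have hp : p = [] := by simpa using hyp.symm
      subst hp
      obtain ⟨a', b', m, h⟩ := hGform _ hG
      have := congrArg List.length h
      simp [encG_nil] at this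
    obtain ⟨y', e, rfl⟩ := List.eq_nil_or_concat y |>.resolve_left hy
    refine ⟨a, e.2, encG y' ++ List.replicate e.1 none, ?_⟩
    rw [List.concat_eq_append, encG_append, encG_cons, encG_nil]; simp
  · have e1 : ∀ (a : α) s, eraseZeros (some a :: s) = a :: eraseZeros s := by
      intro a s; simp [eraseZeros]
    rw [e1, e1, encG_erase, encG_erase, hyp]

theorem regular_of_rel {A τ : Type} [Finite τ] (L : Language A) (R : List A → τ → Prop)
    (h1 : ∀ s, ∃ t, R s t) (h2 : ∀ s s' t, R s t → R s' t → ∀ z, s ++ z ∈ L → s' ++ z ∈ L) :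
    L.IsRegular := by
  apply Language.IsRegular.of_finite_range_leftQuotient
  choose f hf using h1
  have hF : Function.FactorsThrough L.leftQuotient f := by
    intro s s' h
    have hs := hf s
    rw [h] at hs
    ext z
    exact ⟨h2 _ _ _ hs (hf s') z, h2 _ _ _ (hf s') hs z⟩
  refine (Set.finite_range (Function.extend f L.leftQuotient fun _ => L)).subset ?_
  rintro _ ⟨s, rfl⟩
  exact ⟨f s, hF.extend_apply _ s⟩

/-- For a regular language `L` over `Σ = Σ₀ ∪ {0}` and a finite
set of guides `G ⊆ Σ₀·Σ*·Σ₀`, if for some `k` no string of `L` or of `G` contains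
`k` consecutive `0`'s, then `L_{i/d}` is regular. -/
theorem insertion_deletion_preserves_regularity
    {α₀ : Type} [Fintype α₀] (G : Set (List (Option α₀))) (hGfin : G.Finite)
    (hGform : ∀ g ∈ G, ∃ (a b : α₀) (m : List (Option α₀)), g = some a :: m ++ [some b])
    (L : Language (Option α₀)) (hL : L.IsRegular) (k : ℕ)
    (hLk : ∀ u ∈ L, ¬ (List.replicate k (none : Option α₀) <:+: u))
    (hGk : ∀ g ∈ G, ¬ (List.replicate k (none : Option α₀) <:+: g)) :
    Language.IsRegular
      {v : List (Option α₀) | ∃ u ∈ L, Relation.ReflTransGen (IdStep G) u v} := by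
    classical
  obtain ⟨σ, _, M, rfl⟩ := hL
  obtain ⟨l, hl⟩ : ∃ l : ℕ, ∀ g ∈ G, g.length ≤ l := by
    obtain ⟨l, hl⟩ := (hGfin.image List.length).bddAbove
    exact ⟨l, fun g hg => hl ⟨g, hg, rfl⟩⟩
  obtain ⟨τ, _, f, hf⟩ := coreG (encGuides k G) l (by
    rintro ⟨a, p⟩ hg
    have h1 := hl _ hg
    have h2 := encG_len p
    simp at h1 ⊢; omega) (fun w => M.eval (encG w))
  have key : ∀ (v : List (Option α₀)),
      (∃ u ∈ M.accepts, Relation.ReflTransGen (IdStep G) u v) →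
      ∃ (w w' : List (Fin k × α₀)) (c : Fin k), v = encG w' ++ List.replicate c none ∧
        encG w ++ List.replicate c none ∈ M.accepts ∧
        Relation.ReflTransGen (CStepG (encGuides k G)) w w' := by
    rintro v ⟨u, hu, huv⟩
    obtain ⟨w, c, rfl⟩ := decG u (hLk u hu)
    suffices ∃ w', v = encG w' ++ List.replicate c none ∧
        Relation.ReflTransGen (CStepG (encGuides k G)) w w' by
      obtain ⟨w', h1, h2⟩ := this
      exact ⟨w, w', c, h1, hu, h2⟩
    induction huv with
    | refl => exact ⟨w, rfl, .refl⟩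
    | tail _ hs ih =>
      obtain ⟨w', rfl, h2⟩ := ih
      obtain ⟨w'', h3, h4⟩ := idstep_fwd hGform hGk w' c _ hs
      exact ⟨w'', h3, h2.tail h4⟩
  refine regular_of_rel (τ := Option (Fin k × τ)) _ (fun s t => match t with
    | none => ¬ ∃ (w : List (Fin k × α₀)) (c : Fin k), s = encG w ++ List.replicate c none
    | some (c, t) => ∃ w : List (Fin k × α₀), s = encG w ++ List.replicate c none ∧ f w = t) ?_ ?_
  · intro s
    by_cases h : ∃ (w : List (Fin k × α₀)) (c : Fin k), s = encG w ++ List.replicate c none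
    · obtain ⟨w, c, h⟩ := h
      exact ⟨some (c, f w), w, h, rfl⟩
    · exact ⟨none, h⟩
  · intro s s' t hs hs' z hz
    obtain ⟨uw, vw, d, hv, hacc, hreach⟩ := key _ hz
    have hnz := encG_nz vw d
    rw [← hv] at hnz
    match t, hs, hs' with
    | none, hs, _ =>
      exact absurd (decG s fun h => hnz (h.trans ⟨[], z, by simp⟩)) hs
    | some (c, t), hs, hs' =>
      obtain ⟨x, rfl, hx⟩ := hs
      obtain ⟨y, rfl, hy⟩ := hs'
      obtain ⟨zw, d', hzw⟩ := decG (List.replicate c none ++ z) (k := k)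
        fun h => hnz (h.trans ⟨encG x, [], by simp⟩)
      rw [List.append_assoc, hzw, ← List.append_assoc, ← encG_append] at hv
      obtain ⟨rfl, hd⟩ := encG_inj _ _ _ _ hv
      obtain ⟨u₀, u₁, u₀', rfl, hφ, hr⟩ := hf x y (hx.trans hy.symm) zw uw hreach
      refine ⟨encG (u₀' ++ u₁) ++ List.replicate d none, ?_, ?_⟩
      · rw [DFA.mem_accepts, encG_append, List.append_assoc, DFA.eval, DFA.evalFrom_of_append] at hacc ⊢
        have hφ' : M.evalFrom M.start (encG u₀) = M.evalFrom M.start (encG u₀') := hφ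
        rwa [← hφ']
      · rw [List.append_assoc, hzw, ← List.append_assoc, ← encG_append, hd]
        exact Relation.ReflTransGen.lift (fun w => encG w ++ List.replicate d none)
          (fun a b h => idstep_bwd hGform a b d h) _ _ hr
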